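/- Let A, B, C satisfy condition (ABC) and F(y) = 3Ay² + By + C. Let ψ : ℝ × [-1,1] → ℝ be a smooth function such that every partial derivative of ψ of order between 1 and 3 is square-integrable over the strip S = ℝ × (-1,1). If ψ satisfies the linearized stream-function equation ψ_xxxx + 2ψ_xxyy + ψ_yyyy − [F(y)(ψ_xyy + ψ_xxx) − 6Aψ_x] = 0 in S together with the boundary conditions ψ(x,±1) = ψ_x(x,±1) = ψ_y(x,±1) = 0 for all x ∈ ℝ, then ψ is identically zero. -/

import Mathlib

open MeasureTheory

/-- Partial derivative in the first (horizontal) variable. -/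
noncomputable def pdx (f : ℝ → ℝ → ℝ) : ℝ → ℝ → ℝ := fun x y => deriv (fun t => f t y) x

/-- Partial derivative in the second (vertical) variable. -/
noncomputable def pdy (f : ℝ → ℝ → ℝ) : ℝ → ℝ → ℝ := fun x y => deriv (fun t => f x t) y

open Set Filter Topology

section PartialDerivatives

variable {f : ℝ → ℝ → ℝ}

lemma hasDerivAt_fst_of_contDiff (hf : ContDiff ℝ (⊤ : ℕ∞) (Function.uncurry f)) (x y : ℝ) :
    HasDerivAt (fun t => f t y) (fderiv ℝ (Function.uncurry f) (x, y) (1, 0)) x := by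
  have h1 : HasFDerivAt (Function.uncurry f) (fderiv ℝ (Function.uncurry f) (x, y)) (x, y) :=
    (hf.differentiable (by simp)).differentiableAt.hasFDerivAt
  exact h1.comp_hasDerivAt x ((hasDerivAt_id x).prodMk (hasDerivAt_const x y))

lemma hasDerivAt_snd_of_contDiff (hf : ContDiff ℝ (⊤ : ℕ∞) (Function.uncurry f)) (x y : ℝ) :
    HasDerivAt (fun t => f x t) (fderiv ℝ (Function.uncurry f) (x, y) (0, 1)) y := by
  have h1 : HasFDerivAt (Function.uncurry f) (fderiv ℝ (Function.uncurry f) (x, y)) (x, y) :=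
    (hf.differentiable (by simp)).differentiableAt.hasFDerivAt
  exact h1.comp_hasDerivAt y ((hasDerivAt_const y x).prodMk (hasDerivAt_id y))

lemma uncurry_pdx (hf : ContDiff ℝ (⊤ : ℕ∞) (Function.uncurry f)) :
    Function.uncurry (pdx f) = fun p => fderiv ℝ (Function.uncurry f) p (1, 0) := by
  ext ⟨x, y⟩
  exact (hasDerivAt_fst_of_contDiff hf x y).deriv

lemma uncurry_pdy (hf : ContDiff ℝ (⊤ : ℕ∞) (Function.uncurry f)) :
    Function.uncurry (pdy f) = fun p => fderiv ℝ (Function.uncurry f) p (0, 1) := by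
  ext ⟨x, y⟩
  exact (hasDerivAt_snd_of_contDiff hf x y).deriv

lemma contDiff_pdx (hf : ContDiff ℝ (⊤ : ℕ∞) (Function.uncurry f)) :
    ContDiff ℝ (⊤ : ℕ∞) (Function.uncurry (pdx f)) := by
  rw [uncurry_pdx hf]
  exact (hf.fderiv_right (m := (⊤ : ℕ∞)) (by simp)).clm_apply contDiff_const

lemma contDiff_pdy (hf : ContDiff ℝ (⊤ : ℕ∞) (Function.uncurry f)) :
    ContDiff ℝ (⊤ : ℕ∞) (Function.uncurry (pdy f)) := by
  rw [uncurry_pdy hf]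
  exact (hf.fderiv_right (m := (⊤ : ℕ∞)) (by simp)).clm_apply contDiff_const

lemma pdy_pdx_comm (hf : ContDiff ℝ (⊤ : ℕ∞) (Function.uncurry f)) :
    pdy (pdx f) = pdx (pdy f) := by
  have hd : Differentiable ℝ (fderiv ℝ (Function.uncurry f)) :=
    (hf.fderiv_right (m := (⊤ : ℕ∞)) (by simp)).differentiable (by simp)
  have key : ∀ (p v w : ℝ × ℝ), fderiv ℝ (fun q => fderiv ℝ (Function.uncurry f) q v) p w
      = fderiv ℝ (fderiv ℝ (Function.uncurry f)) p w v := by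
    intro p v w
    rw [fderiv_clm_apply hd.differentiableAt (differentiableAt_const v)]
    simp
  have hsymm : ∀ p, IsSymmSndFDerivAt ℝ (Function.uncurry f) p := fun p =>
    hf.contDiffAt.isSymmSndFDerivAt (by simp; exact WithTop.coe_le_coe.2 le_top)
  ext x y
  have h1 : pdy (pdx f) x y = fderiv ℝ (Function.uncurry (pdx f)) (x, y) (0, 1) :=
    (hasDerivAt_snd_of_contDiff (contDiff_pdx hf) x y).deriv
  have h2 : pdx (pdy f) x y = fderiv ℝ (Function.uncurry (pdy f)) (x, y) (1, 0) :=
    (hasDerivAt_fst_of_contDiff (contDiff_pdy hf) x y).deriv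
  rw [h1, h2, uncurry_pdx hf, uncurry_pdy hf, key, key]
  exact hsymm (x, y) _ _

/-- The mixed partial derivative `∂ₓⁱ ∂ᵧʲ f`. -/
noncomputable def mixedPartial (f : ℝ → ℝ → ℝ) (i j : ℕ) : ℝ → ℝ → ℝ := pdx^[i] (pdy^[j] f)

lemma contDiff_mixedPartial (hf : ContDiff ℝ (⊤ : ℕ∞) (Function.uncurry f)) (i j : ℕ) :
    ContDiff ℝ (⊤ : ℕ∞) (Function.uncurry (mixedPartial f i j)) := by
  have hy : ContDiff ℝ (⊤ : ℕ∞) (Function.uncurry (pdy^[j] f)) := by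
    induction j with
    | zero => simpa using hf
    | succ j ih => rw [Function.iterate_succ_apply']; exact contDiff_pdy ih
  induction i with
  | zero => exact hy
  | succ i ih =>
    rw [mixedPartial, Function.iterate_succ_apply']
    exact contDiff_pdx ih

lemma pdx_mixedPartial (i j : ℕ) : pdx (mixedPartial f i j) = mixedPartial f (i + 1) j := by
  rw [mixedPartial, mixedPartial, Function.iterate_succ_apply']

lemma pdy_mixedPartial (hf : ContDiff ℝ (⊤ : ℕ∞) (Function.uncurry f)) (i j : ℕ) :
    pdy (mixedPartial f i j) = mixedPartial f i (j + 1) := by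
  induction i with
  | zero => simp only [mixedPartial, Function.iterate_zero, id, Function.iterate_succ_apply']
  | succ i ih =>
    rw [← pdx_mixedPartial, pdy_pdx_comm (contDiff_mixedPartial hf i j), ih, pdx_mixedPartial]

lemma hasDerivAt_mixedPartial_fst (hf : ContDiff ℝ (⊤ : ℕ∞) (Function.uncurry f)) (i j : ℕ)
    (x y : ℝ) :
    HasDerivAt (fun t => mixedPartial f i j t y) (mixedPartial f (i + 1) j x y) x := by
  rw [← pdx_mixedPartial]
  exact (hasDerivAt_fst_of_contDiff (contDiff_mixedPartial hf i j) x y).differentiableAt.hasDerivAt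

lemma hasDerivAt_mixedPartial_snd (hf : ContDiff ℝ (⊤ : ℕ∞) (Function.uncurry f)) (i j : ℕ)
    (x y : ℝ) :
    HasDerivAt (fun t => mixedPartial f i j x t) (mixedPartial f i (j + 1) x y) y := by
  rw [← pdy_mixedPartial hf]
  exact (hasDerivAt_snd_of_contDiff (contDiff_mixedPartial hf i j) x y).differentiableAt.hasDerivAt

lemma continuous_mixedPartial (hf : ContDiff ℝ (⊤ : ℕ∞) (Function.uncurry f)) (i j : ℕ) :
    Continuous (fun p : ℝ × ℝ => mixedPartial f i j p.1 p.2) :=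
  (contDiff_mixedPartial hf i j).continuous

end PartialDerivatives

/-- Lebesgue measure on the strip `ℝ × (-1, 1)`. -/
noncomputable def stripMeasure : Measure (ℝ × ℝ) :=
  (volume : Measure ℝ).prod (volume.restrict (Ioo (-1 : ℝ) 1))

lemma stripMeasure_eq : stripMeasure = volume.restrict (univ ×ˢ Ioo (-1 : ℝ) 1) := by
  rw [stripMeasure, Measure.volume_eq_prod, ← Measure.prod_restrict, Measure.restrict_univ]

lemma ae_stripMeasure {p : ℝ × ℝ → Prop} (h : ∀ x, ∀ y ∈ Ioo (-1 : ℝ) 1, p (x, y)) :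
    ∀ᵐ q ∂stripMeasure, p q := by
  rw [stripMeasure_eq]
  exact (ae_restrict_iff' (MeasurableSet.univ.prod measurableSet_Ioo)).2
    (Eventually.of_forall fun q hq => h q.1 q.2 hq.2)

lemma setIntegral_Ioo_eq_intervalIntegral (g : ℝ → ℝ) :
    ∫ y in Ioo (-1 : ℝ) 1, g y = ∫ y in (-1 : ℝ)..1, g y := by
  rw [intervalIntegral.integral_of_le (by norm_num), integral_Ioc_eq_integral_Ioo]

/-- Divergence theorem on the strip for a field `(P, Q)` with `P` integrable, `Q` vanishing on the
boundary, and integrable divergence `E`. -/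
lemma integral_divergence_strip_eq_zero {P Px Q Qy E : ℝ → ℝ → ℝ}
    (hP : ∀ x, ∀ y ∈ Icc (-1 : ℝ) 1, HasDerivAt (fun t => P t y) (Px x y) x)
    (hQ : ∀ x, ∀ y ∈ Icc (-1 : ℝ) 1, HasDerivAt (fun t => Q x t) (Qy x y) y)
    (hPc : Continuous (fun p : ℝ × ℝ => P p.1 p.2))
    (hPxc : Continuous (fun p : ℝ × ℝ => Px p.1 p.2))
    (hQyc : Continuous (fun p : ℝ × ℝ => Qy p.1 p.2))
    (hQ0 : ∀ x, Q x (-1) = 0 ∧ Q x 1 = 0)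
    (hE : ∀ x, ∀ y ∈ Ioo (-1 : ℝ) 1, Px x y + Qy x y = E x y)
    (hPi : Integrable (fun p : ℝ × ℝ => P p.1 p.2) stripMeasure)
    (hEi : Integrable (fun p : ℝ × ℝ => E p.1 p.2) stripMeasure) :
    ∫ p, E p.1 p.2 ∂stripMeasure = 0 := by
  have hslice : ∀ {g : ℝ → ℝ → ℝ}, Continuous (fun p : ℝ × ℝ => g p.1 p.2) →
      ∀ x, Continuous (g x) := fun hg x => hg.comp (Continuous.prodMk_right x)
  have hderiv : ∀ x, HasDerivAt (fun t => ∫ y in Ioo (-1 : ℝ) 1, P t y)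
      (∫ y in Ioo (-1 : ℝ) 1, E x y) x := by
    intro x
    have hEx : ∫ y in Ioo (-1 : ℝ) 1, E x y = ∫ y in (-1 : ℝ)..1, Px x y := by
      rw [← setIntegral_congr_fun measurableSet_Ioo (fun y hy => hE x y hy),
        setIntegral_Ioo_eq_intervalIntegral, intervalIntegral.integral_add
          ((hslice hPxc x).intervalIntegrable _ _) ((hslice hQyc x).intervalIntegrable _ _),
        intervalIntegral.integral_eq_sub_of_hasDerivAt
          (fun y hy => hQ x y (by rwa [uIcc_of_le (by norm_num)] at hy))
          ((hslice hQyc x).intervalIntegrable _ _), (hQ0 x).1, (hQ0 x).2]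
      simp
    obtain ⟨K, hK⟩ := ((isCompact_closedBall x 1).prod (isCompact_Icc (a := (-1 : ℝ)) (b := 1))
      ).exists_bound_of_continuousOn hPxc.continuousOn
    have hmem : ∀ y ∈ uIoc (-1 : ℝ) 1, y ∈ Icc (-1 : ℝ) 1 := fun y hy => by
      rw [uIoc_of_le (by norm_num)] at hy
      exact Ioc_subset_Icc_self hy
    rw [hEx]
    simp only [setIntegral_Ioo_eq_intervalIntegral]
    exact (intervalIntegral.hasDerivAt_integral_of_dominated_loc_of_deriv_le
      (bound := fun _ => K) (Metric.closedBall_mem_nhds x one_pos)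
      (Eventually.of_forall fun t => (hslice hPc t).aestronglyMeasurable)
      ((hslice hPc x).intervalIntegrable _ _) (hslice hPxc x).aestronglyMeasurable
      (Eventually.of_forall fun y hy t ht => hK (t, y) ⟨ht, hmem y hy⟩)
      intervalIntegrable_const
      (Eventually.of_forall fun y hy t _ => hP t y (hmem y hy))).2
  rw [stripMeasure, integral_prod _ hEi]
  exact integral_eq_zero_of_hasDerivAt_of_integrable hderiv hEi.integral_prod_left
    hPi.integral_prod_left

/-- Cauchy–Schwarz on an interval for the constant function. -/
lemma sq_intervalIntegral_le {g : ℝ → ℝ} (hg : Continuous g) {a b : ℝ} (hab : a ≤ b) :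
    (∫ t in a..b, g t) ^ 2 ≤ (b - a) * ∫ t in a..b, g t ^ 2 := by
  rcases hab.eq_or_lt with rfl | hlt
  · simp
  set m := (∫ t in a..b, g t) / (b - a) with hm
  have h0 : 0 ≤ ∫ t in a..b, (g t - m) ^ 2 :=
    intervalIntegral.integral_nonneg hab fun t _ => sq_nonneg _
  have h1 : ∫ t in a..b, (g t - m) ^ 2
      = (∫ t in a..b, g t ^ 2) - 2 * m * (∫ t in a..b, g t) + m ^ 2 * (b - a) := by
    have : (fun t => (g t - m) ^ 2) = fun t => (g t ^ 2 - 2 * m * g t) + m ^ 2 := by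
      ext t; ring
    rw [this, intervalIntegral.integral_add, intervalIntegral.integral_sub,
      intervalIntegral.integral_const_mul, intervalIntegral.integral_const, smul_eq_mul]
    · ring
    all_goals exact Continuous.intervalIntegrable (by fun_prop) _ _
  have hpos : 0 < b - a := sub_pos.2 hlt
  have h2 : ∫ t in a..b, g t = m * (b - a) := by rw [hm]; field_simp
  rw [h1, h2] at h0
  rw [h2]
  nlinarith

/-- A function vanishing at `±1` is controlled by the distance to the boundary and the Dirichlet
integral. -/
lemma sq_le_dist_mul_integral_deriv_sq {g g' : ℝ → ℝ}
    (hd : ∀ y ∈ Icc (-1 : ℝ) 1, HasDerivAt g (g' y) y) (hc : Continuous g')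
    (h1 : g (-1) = 0) (h2 : g 1 = 0) {y : ℝ} (hy : y ∈ Icc (-1 : ℝ) 1) :
    g y ^ 2 ≤ (1 - |y|) * ∫ t in Ioo (-1 : ℝ) 1, g' t ^ 2 := by
  rw [setIntegral_Ioo_eq_intervalIntegral]
  have hii : ∀ a b, IntervalIntegrable (fun t => g' t ^ 2) volume a b := fun a b =>
    Continuous.intervalIntegrable (by fun_prop) _ _
  have hsplit := intervalIntegral.integral_add_adjacent_intervals (hii (-1) y) (hii y 1)
  have hn1 : 0 ≤ ∫ t in (-1 : ℝ)..y, g' t ^ 2 :=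
    intervalIntegral.integral_nonneg hy.1 fun t _ => sq_nonneg _
  have hn2 : 0 ≤ ∫ t in y..(1 : ℝ), g' t ^ 2 :=
    intervalIntegral.integral_nonneg hy.2 fun t _ => sq_nonneg _
  rcases le_total 0 y with hy0 | hy0
  · have hft := intervalIntegral.integral_eq_sub_of_hasDerivAt (a := y) (b := 1) (f := g)
      (fun t ht => hd t (by rw [uIcc_of_le hy.2] at ht; exact ⟨hy.1.trans ht.1, ht.2⟩))
      (hc.intervalIntegrable _ _)
    have hcs := sq_intervalIntegral_le hc hy.2
    rw [hft, h2] at hcs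
    rw [abs_of_nonneg hy0]
    have := mul_nonneg (sub_nonneg.2 hy.2) hn1
    nlinarith
  · have hft := intervalIntegral.integral_eq_sub_of_hasDerivAt (a := -1) (b := y) (f := g)
      (fun t ht => hd t (by rw [uIcc_of_le hy.1] at ht; exact ⟨ht.1, ht.2.trans hy.2⟩))
      (hc.intervalIntegrable _ _)
    have hcs := sq_intervalIntegral_le hc hy.1
    rw [hft, h1] at hcs
    rw [abs_of_nonpos hy0]
    have := mul_nonneg (sub_nonneg.2 hy.1) hn2
    nlinarith

lemma memLp_coeff_mul {a : ℝ → ℝ} (ha : Continuous a) {f : ℝ × ℝ → ℝ}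
    (hf : MemLp f 2 stripMeasure) : MemLp (fun p => a p.2 * f p) 2 stripMeasure := by
  obtain ⟨K, hK⟩ := (isCompact_Icc (a := (-1 : ℝ)) (b := 1)).exists_bound_of_continuousOn
    ha.continuousOn
  refine hf.of_le_mul (c := K)
    ((ha.comp continuous_snd).aestronglyMeasurable.mul hf.aestronglyMeasurable) ?_
  refine ae_stripMeasure fun x y hy => ?_
  rw [norm_mul]
  exact mul_le_mul_of_nonneg_right (hK y (Ioo_subset_Icc_self hy)) (norm_nonneg _)

lemma integrable_coeff_mul_mul {a : ℝ → ℝ} (ha : Continuous a) {f g : ℝ × ℝ → ℝ}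
    (hf : MemLp f 2 stripMeasure) (hg : MemLp g 2 stripMeasure) :
    Integrable (fun p => a p.2 * f p * g p) stripMeasure :=
  (memLp_coeff_mul ha hf).integrable_mul hg

lemma integrable_sq_integral_slice {g : ℝ → ℝ → ℝ}
    (hg : MemLp (fun p : ℝ × ℝ => g p.1 p.2) 2 stripMeasure) :
    Integrable (fun p : ℝ × ℝ => ∫ t in Ioo (-1 : ℝ) 1, g p.1 t ^ 2) stripMeasure := by
  have h := hg.integrable_sq
  rw [stripMeasure] at h ⊢
  exact Integrable.comp_fst h.integral_prod_left _

lemma integral_sq_integral_slice {g : ℝ → ℝ → ℝ}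
    (hg : MemLp (fun p : ℝ × ℝ => g p.1 p.2) 2 stripMeasure) :
    ∫ p : ℝ × ℝ, (∫ t in Ioo (-1 : ℝ) 1, g p.1 t ^ 2) ∂stripMeasure
      = 2 * ∫ p : ℝ × ℝ, g p.1 p.2 ^ 2 ∂stripMeasure := by
  have h := hg.integrable_sq
  have h' := integrable_sq_integral_slice hg
  rw [stripMeasure] at h h' ⊢
  rw [integral_prod _ h, integral_prod _ h']
  simp only [integral_const, smul_eq_mul]
  rw [integral_const_mul]
  congr 1
  simp [Measure.real]
  norm_num

lemma memLp_of_memLp_deriv_snd {g gy : ℝ → ℝ → ℝ} (hgc : Continuous (fun p : ℝ × ℝ => g p.1 p.2))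
    (hd : ∀ x, ∀ y ∈ Icc (-1 : ℝ) 1, HasDerivAt (g x) (gy x y) y)
    (hc : Continuous (fun p : ℝ × ℝ => gy p.1 p.2))
    (h1 : ∀ x, g x (-1) = 0) (h2 : ∀ x, g x 1 = 0)
    (hg : MemLp (fun p : ℝ × ℝ => gy p.1 p.2) 2 stripMeasure) :
    MemLp (fun p : ℝ × ℝ => g p.1 p.2) 2 stripMeasure := by
  rw [memLp_two_iff_integrable_sq hgc.aestronglyMeasurable]
  refine (integrable_sq_integral_slice hg).mono' (by fun_prop) (ae_stripMeasure fun x y hy => ?_)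
  rw [Real.norm_of_nonneg (sq_nonneg _)]
  have := sq_le_dist_mul_integral_deriv_sq (hd x) (hc.comp (Continuous.prodMk_right x))
    (h1 x) (h2 x) (Ioo_subset_Icc_self hy)
  have hn : 0 ≤ ∫ t in Ioo (-1 : ℝ) 1, gy x t ^ 2 := integral_nonneg fun t => sq_nonneg _
  have := mul_nonneg (abs_nonneg y) hn
  simp only at *
  nlinarith

/-- A Hardy-type bound: for `w` vanishing on the boundary and a weight `Φ ≥ c (1 - |y|)`, the
Dirichlet integral of `w` is controlled by `∫ Φ (Δw)²`. -/
lemma integral_deriv_sq_le_of_weight {w wx wy wxx wyy : ℝ → ℝ → ℝ} {Φ : ℝ → ℝ} {c : ℝ} (hc : 0 < c)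
    (hΦ : Continuous Φ) (hΦpos : ∀ y ∈ Icc (-1 : ℝ) 1, 0 < Φ y)
    (hΦc : ∀ y ∈ Icc (-1 : ℝ) 1, c * (1 - |y|) ≤ Φ y)
    (hwx : ∀ x, ∀ y ∈ Icc (-1 : ℝ) 1, HasDerivAt (fun t => w t y) (wx x y) x)
    (hwxx : ∀ x, ∀ y ∈ Icc (-1 : ℝ) 1, HasDerivAt (fun t => wx t y) (wxx x y) x)
    (hwy : ∀ x, ∀ y ∈ Icc (-1 : ℝ) 1, HasDerivAt (fun t => w x t) (wy x y) y)
    (hwyy : ∀ x, ∀ y ∈ Icc (-1 : ℝ) 1, HasDerivAt (fun t => wy x t) (wyy x y) y)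
    (cw : Continuous (fun p : ℝ × ℝ => w p.1 p.2))
    (cwx : Continuous (fun p : ℝ × ℝ => wx p.1 p.2))
    (cwy : Continuous (fun p : ℝ × ℝ => wy p.1 p.2))
    (cwxx : Continuous (fun p : ℝ × ℝ => wxx p.1 p.2))
    (cwyy : Continuous (fun p : ℝ × ℝ => wyy p.1 p.2))
    (mw : MemLp (fun p : ℝ × ℝ => w p.1 p.2) 2 stripMeasure)
    (mwx : MemLp (fun p : ℝ × ℝ => wx p.1 p.2) 2 stripMeasure)
    (mwy : MemLp (fun p : ℝ × ℝ => wy p.1 p.2) 2 stripMeasure)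
    (mwxx : MemLp (fun p : ℝ × ℝ => wxx p.1 p.2) 2 stripMeasure)
    (mwyy : MemLp (fun p : ℝ × ℝ => wyy p.1 p.2) 2 stripMeasure)
    (h1 : ∀ x, w x (-1) = 0) (h2 : ∀ x, w x 1 = 0) :
    ∫ p : ℝ × ℝ, wy p.1 p.2 ^ 2 ∂stripMeasure
      ≤ 2 / c * ∫ p : ℝ × ℝ, Φ p.2 * (wxx p.1 p.2 + wyy p.1 p.2) ^ 2 ∂stripMeasure := by
  have mlap : MemLp (fun p : ℝ × ℝ => wxx p.1 p.2 + wyy p.1 p.2) 2 stripMeasure := mwxx.add mwyy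
  have iwx := mwx.integrable_sq
  have iwy := mwy.integrable_sq
  have iwlap : Integrable (fun p : ℝ × ℝ => w p.1 p.2 * (wxx p.1 p.2 + wyy p.1 p.2))
    stripMeasure := mw.integrable_mul mlap
  have iΦ : Integrable (fun p : ℝ × ℝ => Φ p.2 * (wxx p.1 p.2 + wyy p.1 p.2) ^ 2)
      stripMeasure := by
    simpa only [sq, mul_assoc] using integrable_coeff_mul_mul hΦ mlap mlap
  have igrad : Integrable (fun p : ℝ × ℝ => wx p.1 p.2 ^ 2 + wy p.1 p.2 ^ 2) stripMeasure :=
    iwx.add iwy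
  have hdiv : ∫ p : ℝ × ℝ, ((wx p.1 p.2 ^ 2 + wy p.1 p.2 ^ 2)
      + w p.1 p.2 * (wxx p.1 p.2 + wyy p.1 p.2)) ∂stripMeasure = 0 := by
    refine integral_divergence_strip_eq_zero
      (P := fun x y => w x y * wx x y) (Q := fun x y => w x y * wy x y)
      (Px := fun x y => wx x y * wx x y + w x y * wxx x y)
      (Qy := fun x y => wy x y * wy x y + w x y * wyy x y)
      (E := fun x y => (wx x y ^ 2 + wy x y ^ 2) + w x y * (wxx x y + wyy x y))
      (fun x y hy => (hwx x y hy).mul (hwxx x y hy)) (fun x y hy => (hwy x y hy).mul (hwyy x y hy))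
      (by fun_prop) (by fun_prop) (by fun_prop) (fun x => by simp [h1, h2])
      (fun x y _ => by ring) (mw.integrable_mul mwx) (igrad.add iwlap)
  rw [integral_add igrad iwlap, integral_add iwx iwy] at hdiv
  have iS := integrable_sq_integral_slice mwy
  have hS := integral_sq_integral_slice mwy
  have hyoung : ∫ p : ℝ × ℝ, -(w p.1 p.2 * (wxx p.1 p.2 + wyy p.1 p.2)) ∂stripMeasure
      ≤ ∫ p : ℝ × ℝ, (1 / 4 * (∫ t in Ioo (-1 : ℝ) 1, wy p.1 t ^ 2)
        + 1 / c * (Φ p.2 * (wxx p.1 p.2 + wyy p.1 p.2) ^ 2)) ∂stripMeasure := by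
    refine integral_mono_ae iwlap.neg ((iS.const_mul _).add (iΦ.const_mul _))
      (ae_stripMeasure fun x y hy => ?_)
    have hy' := Ioo_subset_Icc_self hy
    have hb := sq_le_dist_mul_integral_deriv_sq (hwy x) (cwy.comp (Continuous.prodMk_right x))
      (h1 x) (h2 x) hy'
    simp only at hb ⊢
    set H := ∫ t in Ioo (-1 : ℝ) 1, wy x t ^ 2
    have hH : 0 ≤ H := integral_nonneg fun t => sq_nonneg _
    set L := wxx x y + wyy x y
    have hΦy := hΦpos y hy'
    have hcw : c * w x y ^ 2 ≤ Φ y * H := by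
      calc c * w x y ^ 2 ≤ c * ((1 - |y|) * H) := by gcongr
        _ = c * (1 - |y|) * H := by ring
        _ ≤ Φ y * H := by gcongr; exact hΦc y hy'
    have hid : 0 ≤ (c * w x y + 2 * Φ y * L) ^ 2 / (4 * c * Φ y) := by positivity
    have hexp : (c * w x y + 2 * Φ y * L) ^ 2 / (4 * c * Φ y)
        = c * w x y ^ 2 / (4 * Φ y) + w x y * L + 1 / c * (Φ y * L ^ 2) := by
      field_simp
      ring
    have hle : c * w x y ^ 2 / (4 * Φ y) ≤ 1 / 4 * H := by
      rw [div_le_iff₀ (by positivity)]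
      linarith
    linarith
  rw [integral_neg, integral_add (iS.const_mul _) (iΦ.const_mul _), integral_const_mul,
    integral_const_mul, hS] at hyoung
  have hnx : 0 ≤ ∫ p : ℝ × ℝ, wx p.1 p.2 ^ 2 ∂stripMeasure := integral_nonneg fun p => sq_nonneg _
  have hc2 : 2 / c = 2 * (1 / c) := by ring
  rw [hc2]
  linarith

section Quotient

variable {r r' r'' : ℝ → ℝ} {ψ : ℝ → ℝ → ℝ}

/-- The derivative `∂ₓⁱ (r(y) ψ)`. -/
noncomputable def weighted (r : ℝ → ℝ) (ψ : ℝ → ℝ → ℝ) (i : ℕ) (x y : ℝ) : ℝ :=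
  r y * mixedPartial ψ i 0 x y

/-- The derivative `∂ₓⁱ ∂ᵧ (r(y) ψ)`, where `r'` is the derivative of `r`. -/
noncomputable def weightedDy (r r' : ℝ → ℝ) (ψ : ℝ → ℝ → ℝ) (i : ℕ) (x y : ℝ) : ℝ :=
  r' y * mixedPartial ψ i 0 x y + r y * mixedPartial ψ i 1 x y

/-- The derivative `∂ₓⁱ ∂ᵧ² (r(y) ψ)`, where `r'`, `r''` are the derivatives of `r`. -/
noncomputable def weightedDyy (r r' r'' : ℝ → ℝ) (ψ : ℝ → ℝ → ℝ) (i : ℕ) (x y : ℝ) : ℝ :=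
  (r'' y * mixedPartial ψ i 0 x y + 2 * r' y * mixedPartial ψ i 1 x y)
    + r y * mixedPartial ψ i 2 x y

lemma continuous_weighted (hψ : ContDiff ℝ (⊤ : ℕ∞) (Function.uncurry ψ)) (hr : Continuous r)
    (i : ℕ) : Continuous (fun p : ℝ × ℝ => weighted r ψ i p.1 p.2) := by
  have h0 := continuous_mixedPartial hψ i 0
  unfold weighted
  fun_prop

lemma continuous_weightedDy (hψ : ContDiff ℝ (⊤ : ℕ∞) (Function.uncurry ψ)) (hr : Continuous r)
    (hr' : Continuous r') (i : ℕ) :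
    Continuous (fun p : ℝ × ℝ => weightedDy r r' ψ i p.1 p.2) := by
  have h0 := continuous_mixedPartial hψ i 0
  have h1 := continuous_mixedPartial hψ i 1
  unfold weightedDy
  fun_prop

lemma continuous_weightedDyy (hψ : ContDiff ℝ (⊤ : ℕ∞) (Function.uncurry ψ)) (hr : Continuous r)
    (hr' : Continuous r') (hr'' : Continuous r'') (i : ℕ) :
    Continuous (fun p : ℝ × ℝ => weightedDyy r r' r'' ψ i p.1 p.2) := by
  have h0 := continuous_mixedPartial hψ i 0
  have h1 := continuous_mixedPartial hψ i 1
  have h2 := continuous_mixedPartial hψ i 2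
  unfold weightedDyy
  fun_prop

lemma hasDerivAt_weighted_fst (hψ : ContDiff ℝ (⊤ : ℕ∞) (Function.uncurry ψ)) (i : ℕ) (x y : ℝ) :
    HasDerivAt (fun t => weighted r ψ i t y) (weighted r ψ (i + 1) x y) x :=
  (hasDerivAt_mixedPartial_fst hψ i 0 x y).const_mul _

lemma hasDerivAt_weightedDy_fst (hψ : ContDiff ℝ (⊤ : ℕ∞) (Function.uncurry ψ)) (i : ℕ)
    (x y : ℝ) :
    HasDerivAt (fun t => weightedDy r r' ψ i t y) (weightedDy r r' ψ (i + 1) x y) x :=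
  ((hasDerivAt_mixedPartial_fst hψ i 0 x y).const_mul _).add
    ((hasDerivAt_mixedPartial_fst hψ i 1 x y).const_mul _)

lemma hasDerivAt_weighted_snd (hψ : ContDiff ℝ (⊤ : ℕ∞) (Function.uncurry ψ)) (i : ℕ) (x : ℝ)
    {y : ℝ} (hr : HasDerivAt r (r' y) y) :
    HasDerivAt (fun t => weighted r ψ i x t) (weightedDy r r' ψ i x y) y :=
  hr.mul (hasDerivAt_mixedPartial_snd hψ i 0 x y)

lemma hasDerivAt_weightedDy_snd (hψ : ContDiff ℝ (⊤ : ℕ∞) (Function.uncurry ψ)) (i : ℕ) (x : ℝ)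
    {y : ℝ} (hr : HasDerivAt r (r' y) y) (hr' : HasDerivAt r' (r'' y) y) :
    HasDerivAt (fun t => weightedDy r r' ψ i x t) (weightedDyy r r' r'' ψ i x y) y := by
  refine ((hr'.mul (hasDerivAt_mixedPartial_snd hψ i 0 x y)).add
    (hr.mul (hasDerivAt_mixedPartial_snd hψ i 1 x y))).congr_deriv ?_
  simp only [weightedDyy]
  ring

lemma memLp_weighted (hr : Continuous r) {i : ℕ}
    (h0 : MemLp (fun p : ℝ × ℝ => mixedPartial ψ i 0 p.1 p.2) 2 stripMeasure) :
    MemLp (fun p : ℝ × ℝ => weighted r ψ i p.1 p.2) 2 stripMeasure :=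
  memLp_coeff_mul hr h0

lemma memLp_weightedDy (hr : Continuous r) (hr' : Continuous r') {i : ℕ}
    (h0 : MemLp (fun p : ℝ × ℝ => mixedPartial ψ i 0 p.1 p.2) 2 stripMeasure)
    (h1 : MemLp (fun p : ℝ × ℝ => mixedPartial ψ i 1 p.1 p.2) 2 stripMeasure) :
    MemLp (fun p : ℝ × ℝ => weightedDy r r' ψ i p.1 p.2) 2 stripMeasure :=
  (memLp_coeff_mul hr' h0).add (memLp_coeff_mul hr h1)

lemma memLp_weightedDyy (hr : Continuous r) (hr' : Continuous r') (hr'' : Continuous r'') {i : ℕ}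
    (h0 : MemLp (fun p : ℝ × ℝ => mixedPartial ψ i 0 p.1 p.2) 2 stripMeasure)
    (h1 : MemLp (fun p : ℝ × ℝ => mixedPartial ψ i 1 p.1 p.2) 2 stripMeasure)
    (h2 : MemLp (fun p : ℝ × ℝ => mixedPartial ψ i 2 p.1 p.2) 2 stripMeasure) :
    MemLp (fun p : ℝ × ℝ => weightedDyy r r' r'' ψ i p.1 p.2) 2 stripMeasure :=
  ((memLp_coeff_mul hr'' h0).add (memLp_coeff_mul (hr'.const_mul 2) h1)).add
    (memLp_coeff_mul hr h2)

/-- The energy identity: testing the linearized equation with `w = ψ / Φ`, where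
`Φ = 3 A y² + B y + D`, leaves only `∫ Φ (Δw)² - 12 A ∫ w_y²` and the contribution of the constant
`ε = Φ - F`. -/
lemma energy_identity {A B D ε : ℝ} (hψ : ContDiff ℝ (⊤ : ℕ∞) (Function.uncurry ψ))
    (hm : ∀ i j : ℕ, i + j ≤ 3 →
      MemLp (fun p : ℝ × ℝ => mixedPartial ψ i j p.1 p.2) 2 stripMeasure)
    (heq : ∀ x : ℝ, ∀ y ∈ Ioo (-1 : ℝ) 1,
      mixedPartial ψ 4 0 x y + 2 * mixedPartial ψ 2 2 x y + mixedPartial ψ 0 4 x y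
        = (3 * A * y ^ 2 + B * y + D - ε) * (mixedPartial ψ 1 2 x y + mixedPartial ψ 3 0 x y)
            - 6 * A * mixedPartial ψ 1 0 x y)
    (hbc : ∀ x : ℝ, ∀ y : ℝ, y = -1 ∨ y = 1 → mixedPartial ψ 0 0 x y = 0 ∧
      mixedPartial ψ 1 0 x y = 0 ∧ mixedPartial ψ 0 1 x y = 0)
    (hr : Continuous r) (hr' : Continuous r') (hr'' : Continuous r'')
    (hrd : ∀ y ∈ Icc (-1 : ℝ) 1, HasDerivAt r (r' y) y)
    (hrd' : ∀ y ∈ Icc (-1 : ℝ) 1, HasDerivAt r' (r'' y) y)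
    (hrΦ : ∀ y ∈ Icc (-1 : ℝ) 1, r y * (3 * A * y ^ 2 + B * y + D) = 1)
    (hr'Φ : ∀ y ∈ Icc (-1 : ℝ) 1, r' y = -(6 * A * y + B) * r y ^ 2)
    (hr''Φ : ∀ y ∈ Icc (-1 : ℝ) 1,
      r'' y = -(6 * A) * r y ^ 2 + 2 * (6 * A * y + B) ^ 2 * r y ^ 3) :
    ∫ p : ℝ × ℝ, (3 * A * p.2 ^ 2 + B * p.2 + D)
        * (weighted r ψ 2 p.1 p.2 + weightedDyy r r' r'' ψ 0 p.1 p.2) ^ 2 ∂stripMeasure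
      - 12 * A * ∫ p : ℝ × ℝ, weightedDy r r' ψ 0 p.1 p.2 ^ 2 ∂stripMeasure
      = ∫ p : ℝ × ℝ, -(ε * r p.2) * mixedPartial ψ 0 0 p.1 p.2
        * (mixedPartial ψ 1 2 p.1 p.2 + mixedPartial ψ 3 0 p.1 p.2) ∂stripMeasure := by
  have cD := continuous_mixedPartial hψ
  have cw := continuous_weighted hψ hr
  have cwy := continuous_weightedDy hψ hr hr'
  have cwyy := continuous_weightedDyy hψ hr hr' hr''
  have m00 := hm 0 0 (by norm_num)
  have m10 := hm 1 0 (by norm_num)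
  have m01 := hm 0 1 (by norm_num)
  have m02 := hm 0 2 (by norm_num)
  have m20 := hm 2 0 (by norm_num)
  have m30 := hm 3 0 (by norm_num)
  have m12 := hm 1 2 (by norm_num)
  have mw := memLp_weighted hr m00
  have mwx := memLp_weighted hr m10
  have mwxx := memLp_weighted hr m20
  have mwy := memLp_weightedDy hr hr' m00 m01
  have mwyy := memLp_weightedDyy hr hr' hr'' m00 m01 m02
  have mlapw : MemLp (fun p : ℝ × ℝ => weighted r ψ 2 p.1 p.2 + weightedDyy r r' r'' ψ 0 p.1 p.2)
    2 stripMeasure := mwxx.add mwyy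
  have mlapx : MemLp (fun p : ℝ × ℝ => mixedPartial ψ 1 2 p.1 p.2 + mixedPartial ψ 3 0 p.1 p.2)
    2 stripMeasure := m12.add m30
  have mlap : MemLp (fun p : ℝ × ℝ => mixedPartial ψ 2 0 p.1 p.2 + mixedPartial ψ 0 2 p.1 p.2)
    2 stripMeasure := m20.add m02
  have iΦ : Integrable (fun p : ℝ × ℝ => (3 * A * p.2 ^ 2 + B * p.2 + D)
      * (weighted r ψ 2 p.1 p.2 + weightedDyy r r' r'' ψ 0 p.1 p.2) ^ 2) stripMeasure := by
    refine (integrable_coeff_mul_mul (a := fun y => 3 * A * y ^ 2 + B * y + D) (by fun_prop)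
      mlapw mlapw).congr (Eventually.of_forall fun p => ?_)
    simp only
    ring
  have iwy : Integrable (fun p : ℝ × ℝ => 12 * A * weightedDy r r' ψ 0 p.1 p.2 ^ 2)
    stripMeasure := mwy.integrable_sq.const_mul _
  have iε : Integrable (fun p : ℝ × ℝ => -(ε * r p.2) * mixedPartial ψ 0 0 p.1 p.2
      * (mixedPartial ψ 1 2 p.1 p.2 + mixedPartial ψ 3 0 p.1 p.2)) stripMeasure :=
    integrable_coeff_mul_mul (a := fun y => -(ε * r y)) (by fun_prop) m00 mlapx
  have hdiv : ∫ p : ℝ × ℝ, (-(ε * r p.2) * mixedPartial ψ 0 0 p.1 p.2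
        * (mixedPartial ψ 1 2 p.1 p.2 + mixedPartial ψ 3 0 p.1 p.2)
      - ((3 * A * p.2 ^ 2 + B * p.2 + D)
        * (weighted r ψ 2 p.1 p.2 + weightedDyy r r' r'' ψ 0 p.1 p.2) ^ 2
      - 12 * A * weightedDy r r' ψ 0 p.1 p.2 ^ 2)) ∂stripMeasure = 0 := by
    refine integral_divergence_strip_eq_zero
      (P := fun x y =>
        weighted r ψ 0 x y * (mixedPartial ψ 1 2 x y + mixedPartial ψ 3 0 x y)
        - weighted r ψ 1 x y * (mixedPartial ψ 2 0 x y + mixedPartial ψ 0 2 x y)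
        + (2 * (6 * A * y + B)) * (weightedDy r r' ψ 0 x y * weighted r ψ 1 x y)
        + (6 * A) * (weighted r ψ 0 x y * weighted r ψ 1 x y)
        - (3 * A * y ^ 2 + B * y + D) ^ 2 * (weighted r ψ 0 x y * weighted r ψ 2 x y)
        + ((3 * A * y ^ 2 + B * y + D) ^ 2 / 2) * (weighted r ψ 1 x y * weighted r ψ 1 x y)
        + ((3 * A * y ^ 2 + B * y + D) ^ 2 / 2) * (weightedDy r r' ψ 0 x y * weightedDy r r' ψ 0 x y))
      (Px := fun x y =>
        weighted r ψ 1 x y * (mixedPartial ψ 1 2 x y + mixedPartial ψ 3 0 x y)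
        + weighted r ψ 0 x y * (mixedPartial ψ 2 2 x y + mixedPartial ψ 4 0 x y)
        - (weighted r ψ 2 x y * (mixedPartial ψ 2 0 x y + mixedPartial ψ 0 2 x y)
          + weighted r ψ 1 x y * (mixedPartial ψ 3 0 x y + mixedPartial ψ 1 2 x y))
        + (2 * (6 * A * y + B)) * (weightedDy r r' ψ 1 x y * weighted r ψ 1 x y
          + weightedDy r r' ψ 0 x y * weighted r ψ 2 x y)
        + (6 * A) * (weighted r ψ 1 x y * weighted r ψ 1 x y
          + weighted r ψ 0 x y * weighted r ψ 2 x y)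
        - (3 * A * y ^ 2 + B * y + D) ^ 2 * (weighted r ψ 1 x y * weighted r ψ 2 x y
          + weighted r ψ 0 x y * weighted r ψ 3 x y)
        + ((3 * A * y ^ 2 + B * y + D) ^ 2 / 2) * (weighted r ψ 2 x y * weighted r ψ 1 x y
          + weighted r ψ 1 x y * weighted r ψ 2 x y)
        + ((3 * A * y ^ 2 + B * y + D) ^ 2 / 2)
          * (weightedDy r r' ψ 1 x y * weightedDy r r' ψ 0 x y
            + weightedDy r r' ψ 0 x y * weightedDy r r' ψ 1 x y))
      (Q := fun x y =>
        weighted r ψ 0 x y * (mixedPartial ψ 2 1 x y + mixedPartial ψ 0 3 x y)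
        - weightedDy r r' ψ 0 x y * (mixedPartial ψ 2 0 x y + mixedPartial ψ 0 2 x y)
        + (6 * A * y + B) * (weightedDy r r' ψ 0 x y * weightedDy r r' ψ 0 x y
          - weighted r ψ 1 x y * weighted r ψ 1 x y)
        + (6 * A) * (weighted r ψ 0 x y * weightedDy r r' ψ 0 x y)
        - (3 * A * y ^ 2 + B * y + D) ^ 2 * (weighted r ψ 0 x y * weightedDy r r' ψ 1 x y))
      (Qy := fun x y =>
        weightedDy r r' ψ 0 x y * (mixedPartial ψ 2 1 x y + mixedPartial ψ 0 3 x y)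
        + weighted r ψ 0 x y * (mixedPartial ψ 2 2 x y + mixedPartial ψ 0 4 x y)
        - (weightedDyy r r' r'' ψ 0 x y * (mixedPartial ψ 2 0 x y + mixedPartial ψ 0 2 x y)
          + weightedDy r r' ψ 0 x y * (mixedPartial ψ 2 1 x y + mixedPartial ψ 0 3 x y))
        + ((6 * A) * (weightedDy r r' ψ 0 x y * weightedDy r r' ψ 0 x y
            - weighted r ψ 1 x y * weighted r ψ 1 x y)
          + (6 * A * y + B) * (2 * (weightedDy r r' ψ 0 x y * weightedDyy r r' r'' ψ 0 x y)
            - 2 * (weighted r ψ 1 x y * weightedDy r r' ψ 1 x y)))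
        + (6 * A) * (weightedDy r r' ψ 0 x y * weightedDy r r' ψ 0 x y
          + weighted r ψ 0 x y * weightedDyy r r' r'' ψ 0 x y)
        - ((2 * (3 * A * y ^ 2 + B * y + D) * (6 * A * y + B))
            * (weighted r ψ 0 x y * weightedDy r r' ψ 1 x y)
          + (3 * A * y ^ 2 + B * y + D) ^ 2 * (weightedDy r r' ψ 0 x y * weightedDy r r' ψ 1 x y
            + weighted r ψ 0 x y * weightedDyy r r' r'' ψ 1 x y)))
      (E := fun x y => -(ε * r y) * mixedPartial ψ 0 0 x y
          * (mixedPartial ψ 1 2 x y + mixedPartial ψ 3 0 x y)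
        - ((3 * A * y ^ 2 + B * y + D)
          * (weighted r ψ 2 x y + weightedDyy r r' r'' ψ 0 x y) ^ 2
        - 12 * A * weightedDy r r' ψ 0 x y ^ 2))
      ?_ ?_ (by fun_prop) (by fun_prop) (by fun_prop) ?_ ?_ ?_ (iε.sub (iΦ.sub iwy))
    · intro x y _
      have d := fun i j => hasDerivAt_mixedPartial_fst hψ i j x y
      have w := fun i => hasDerivAt_weighted_fst (r := r) hψ i x y
      have wy := hasDerivAt_weightedDy_fst (r := r) (r' := r') hψ 0 x y
      exact (((((((w 0).mul ((d 1 2).add (d 3 0))).sub ((w 1).mul ((d 2 0).add (d 0 2)))).add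
        ((wy.mul (w 1)).const_mul _)).add (((w 0).mul (w 1)).const_mul _)).sub
        (((w 0).mul (w 2)).const_mul _)).add (((w 1).mul (w 1)).const_mul _)).add
        ((wy.mul wy).const_mul _)
    · intro x y hy
      have d := fun i j => hasDerivAt_mixedPartial_snd hψ i j x y
      have w := fun i => hasDerivAt_weighted_snd hψ i x (hrd y hy)
      have wy := fun i => hasDerivAt_weightedDy_snd hψ i x (hrd y hy) (hrd' y hy)
      have hΦ' : HasDerivAt (fun t : ℝ => 6 * A * t + B) (6 * A) y := by
        simpa using ((hasDerivAt_id y).const_mul (6 * A)).add_const B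
      have hΦ : HasDerivAt (fun t : ℝ => (3 * A * t ^ 2 + B * t + D) ^ 2)
          (2 * (3 * A * y ^ 2 + B * y + D) * (6 * A * y + B)) y := by
        refine (((((hasDerivAt_pow 2 y).const_mul (3 * A)).add
          ((hasDerivAt_id y).const_mul B)).add_const D).pow 2).congr_deriv ?_
        simp only [Pi.add_apply, Nat.cast_ofNat, id]
        ring
      refine (((((w 0).mul ((d 2 1).add (d 0 3))).sub ((wy 0).mul ((d 2 0).add (d 0 2)))).add
        (hΦ'.mul (((wy 0).mul (wy 0)).sub ((w 1).mul (w 1))))).add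
        (((w 0).mul (wy 0)).const_mul (6 * A))).sub
        (hΦ.mul ((w 0).mul (wy 1))) |>.congr_deriv ?_
      simp only [Pi.mul_apply, Pi.add_apply, Pi.sub_apply]
      ring
    · intro x
      have key : ∀ y : ℝ, y = -1 ∨ y = 1 → weighted r ψ 0 x y = 0 ∧ weighted r ψ 1 x y = 0 ∧
          weightedDy r r' ψ 0 x y = 0 := fun y hy => by
        obtain ⟨h0, h1, h2⟩ := hbc x y hy
        simp [weighted, weightedDy, h0, h1, h2]
      obtain ⟨a0, a1, a2⟩ := key (-1) (Or.inl rfl)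
      obtain ⟨b0, b1, b2⟩ := key 1 (Or.inr rfl)
      simp [a0, a1, a2, b0, b1, b2]
    · intro x y hy
      have hy' := Ioo_subset_Icc_self hy
      have hΦr := hrΦ y hy'
      have e1 : mixedPartial ψ 2 0 x y + mixedPartial ψ 0 2 x y
          = (3 * A * y ^ 2 + B * y + D)
              * (weighted r ψ 2 x y + weightedDyy r r' r'' ψ 0 x y)
            + 2 * (6 * A * y + B) * weightedDy r r' ψ 0 x y + 6 * A * weighted r ψ 0 x y := by
        simp only [weighted, weightedDy, weightedDyy, hr'Φ y hy', hr''Φ y hy']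
        linear_combination -(mixedPartial ψ 2 0 x y + mixedPartial ψ 0 2 x y
          - 2 * (6 * A * y + B) * r y * mixedPartial ψ 0 1 x y
          + (-(6 * A) * r y + 2 * (6 * A * y + B) ^ 2 * r y ^ 2) * mixedPartial ψ 0 0 x y) * hΦr
      have e2 : mixedPartial ψ 1 2 x y + mixedPartial ψ 3 0 x y
          = (3 * A * y ^ 2 + B * y + D)
              * (weighted r ψ 3 x y + weightedDyy r r' r'' ψ 1 x y)
            + 2 * (6 * A * y + B) * weightedDy r r' ψ 1 x y + 6 * A * weighted r ψ 1 x y := by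
        simp only [weighted, weightedDy, weightedDyy, hr'Φ y hy', hr''Φ y hy']
        linear_combination -(mixedPartial ψ 3 0 x y + mixedPartial ψ 1 2 x y
          - 2 * (6 * A * y + B) * r y * mixedPartial ψ 1 1 x y
          + (-(6 * A) * r y + 2 * (6 * A * y + B) ^ 2 * r y ^ 2) * mixedPartial ψ 1 0 x y) * hΦr
      have e3 : mixedPartial ψ 1 0 x y = (3 * A * y ^ 2 + B * y + D) * weighted r ψ 1 x y := by
        simp only [weighted]
        linear_combination -mixedPartial ψ 1 0 x y * hΦr
      have e4 : r y * mixedPartial ψ 0 0 x y = weighted r ψ 0 x y := rfl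
      linear_combination weighted r ψ 0 x y * heq x y hy
        - (weighted r ψ 2 x y + weightedDyy r r' r'' ψ 0 x y) * e1
        + weighted r ψ 0 x y * (3 * A * y ^ 2 + B * y + D) * e2
        - 6 * A * weighted r ψ 0 x y * e3
        + ε * (mixedPartial ψ 1 2 x y + mixedPartial ψ 3 0 x y) * e4
    · have iprod : ∀ {a : ℝ → ℝ} (_ : Continuous a) {f g : ℝ × ℝ → ℝ}
          (_ : MemLp f 2 stripMeasure) (_ : MemLp g 2 stripMeasure),
          Integrable (fun p => a p.2 * (f p * g p)) stripMeasure := fun ha _ _ hf hg => by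
        simpa only [mul_assoc] using integrable_coeff_mul_mul ha hf hg
      exact ((((((mw.integrable_mul mlapx).sub (mwx.integrable_mul mlap)).add
        (iprod (a := fun y => 2 * (6 * A * y + B)) (by fun_prop) mwy mwx)).add
        (iprod (a := fun _ => 6 * A) (by fun_prop) mw mwx)).sub
        (iprod (a := fun y => (3 * A * y ^ 2 + B * y + D) ^ 2) (by fun_prop) mw mwxx)).add
        (iprod (a := fun y => (3 * A * y ^ 2 + B * y + D) ^ 2 / 2) (by fun_prop) mwx mwx)).add
        (iprod (a := fun y => (3 * A * y ^ 2 + B * y + D) ^ 2 / 2) (by fun_prop) mwy mwy)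
  have iΦwy : Integrable (fun p : ℝ × ℝ => (3 * A * p.2 ^ 2 + B * p.2 + D)
      * (weighted r ψ 2 p.1 p.2 + weightedDyy r r' r'' ψ 0 p.1 p.2) ^ 2
      - 12 * A * weightedDy r r' ψ 0 p.1 p.2 ^ 2) stripMeasure := iΦ.sub iwy
  rw [integral_sub iε iΦwy, integral_sub iΦ iwy, integral_const_mul] at hdiv
  linarith

end Quotient

/-- The reciprocal of the shifted profile `F + ε`, truncated away from the strip so as to be
continuous on the whole line. -/
noncomputable def shiftedRecip (A B C ε y : ℝ) : ℝ :=
  (max (3 * A * y ^ 2 + B * y + (C + ε)) (ε / 2))⁻¹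

section Profile

variable {A B C ε : ℝ}

lemma profile_lower_bound (hA : A ≤ 0) (hB : |B| ≤ 3 * A + C) {y : ℝ} (hy : y ∈ Icc (-1 : ℝ) 1) :
    C * (1 - |y|) ≤ 3 * A * y ^ 2 + B * y + C := by
  have hy1 : |y| ≤ 1 := abs_le.2 hy
  have h1 : -(|B| * |y|) ≤ B * y := by
    rw [← abs_mul]
    exact neg_abs_le _
  rw [← sq_abs y]
  have h2 := mul_nonneg (sub_nonneg.2 hB) (abs_nonneg y)
  have h3 := mul_nonneg (mul_nonneg (neg_nonneg.2 hA) (abs_nonneg y)) (sub_nonneg.2 hy1)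
  nlinarith

lemma profile_upper_bound (hA : A ≤ 0) (hB : |B| ≤ 3 * A + C) {y : ℝ} (hy : y ∈ Icc (-1 : ℝ) 1) :
    3 * A * y ^ 2 + B * y + C ≤ 2 * C := by
  have hy1 : |y| ≤ 1 := abs_le.2 hy
  have h1 : B * y ≤ |B| * |y| := by
    rw [← abs_mul]
    exact le_abs_self _
  have h2 := mul_nonneg (abs_nonneg B) (sub_nonneg.2 hy1)
  have h3 := mul_nonneg (neg_nonneg.2 hA) (sq_nonneg y)
  nlinarith

lemma profile_const_pos (hABC : (A, B, C) ≠ (0, 0, 0)) (hA : A ≤ 0) (hB : |B| ≤ 3 * A + C) :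
    0 < C := by
  have hB0 := abs_nonneg B
  refine lt_of_le_of_ne (by linarith) fun hC => hABC ?_
  have hA0 : A = 0 := by linarith
  have hB1 : B = 0 := abs_eq_zero.1 (by linarith)
  rw [hA0, hB1, ← hC]

lemma continuous_shiftedRecip (hε : 0 < ε) : Continuous (shiftedRecip A B C ε) := by
  unfold shiftedRecip
  refine Continuous.inv₀ (by fun_prop) fun y => ?_
  exact (lt_max_of_lt_right (by linarith)).ne'

lemma le_shifted_profile (hC : 0 < C) (hA : A ≤ 0) (hB : |B| ≤ 3 * A + C) {y : ℝ}
    (hy : y ∈ Icc (-1 : ℝ) 1) : ε ≤ 3 * A * y ^ 2 + B * y + (C + ε) := by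
  have := profile_lower_bound hA hB hy
  have := mul_nonneg hC.le (sub_nonneg.2 (abs_le.2 hy : |y| ≤ 1))
  linarith

lemma shiftedRecip_eq (hε : 0 < ε) (hC : 0 < C) (hA : A ≤ 0) (hB : |B| ≤ 3 * A + C) {y : ℝ}
    (hy : y ∈ Icc (-1 : ℝ) 1) :
    shiftedRecip A B C ε y = (3 * A * y ^ 2 + B * y + (C + ε))⁻¹ := by
  rw [shiftedRecip, max_eq_left]
  linarith [le_shifted_profile (ε := ε) hC hA hB hy]

lemma hasDerivAt_shiftedRecip (hε : 0 < ε) (hC : 0 < C) (hA : A ≤ 0) (hB : |B| ≤ 3 * A + C)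
    {y : ℝ} (hy : y ∈ Icc (-1 : ℝ) 1) :
    HasDerivAt (shiftedRecip A B C ε) (-(6 * A * y + B) * shiftedRecip A B C ε y ^ 2) y := by
  have hpos := le_shifted_profile (ε := ε) hC hA hB hy
  have hev : shiftedRecip A B C ε =ᶠ[𝓝 y] fun t => (3 * A * t ^ 2 + B * t + (C + ε))⁻¹ := by
    have hcont : Continuous fun t : ℝ => 3 * A * t ^ 2 + B * t + (C + ε) := by fun_prop
    filter_upwards [hcont.continuousAt.eventually_const_lt
      (show ε / 2 < 3 * A * y ^ 2 + B * y + (C + ε) by linarith)] with t ht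
    rw [shiftedRecip, max_eq_left ht.le]
  have hΦ : HasDerivAt (fun t : ℝ => 3 * A * t ^ 2 + B * t + (C + ε)) (6 * A * y + B) y := by
    refine ((((hasDerivAt_pow 2 y).const_mul (3 * A)).add
      ((hasDerivAt_id y).const_mul B)).add_const (C + ε)).congr_deriv ?_
    simp only [Nat.cast_ofNat]
    ring
  refine ((hΦ.inv (by linarith)).congr_of_eventuallyEq hev).congr_deriv ?_
  rw [shiftedRecip_eq hε hC hA hB hy]
  field_simp

end Profile

section Main

variable {A B C : ℝ} {ψ : ℝ → ℝ → ℝ}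

/-- The `L²` norm of a solution is controlled by the error committed in replacing the profile `F`
by `F + ε`. -/
lemma integral_sq_le_shift_error (hC : 0 < C) (hA : A ≤ 0) (hB : |B| ≤ 3 * A + C)
    (hψ : ContDiff ℝ (⊤ : ℕ∞) (Function.uncurry ψ))
    (hm : ∀ i j : ℕ, i + j ≤ 3 →
      MemLp (fun p : ℝ × ℝ => mixedPartial ψ i j p.1 p.2) 2 stripMeasure)
    (heq : ∀ x : ℝ, ∀ y ∈ Ioo (-1 : ℝ) 1,
      mixedPartial ψ 4 0 x y + 2 * mixedPartial ψ 2 2 x y + mixedPartial ψ 0 4 x y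
        = (3 * A * y ^ 2 + B * y + C) * (mixedPartial ψ 1 2 x y + mixedPartial ψ 3 0 x y)
            - 6 * A * mixedPartial ψ 1 0 x y)
    (hbc : ∀ x : ℝ, ∀ y : ℝ, y = -1 ∨ y = 1 → mixedPartial ψ 0 0 x y = 0 ∧
      mixedPartial ψ 1 0 x y = 0 ∧ mixedPartial ψ 0 1 x y = 0)
    {ε : ℝ} (hε : 0 < ε) (hε1 : ε ≤ 1) :
    ∫ p : ℝ × ℝ, mixedPartial ψ 0 0 p.1 p.2 ^ 2 ∂stripMeasure
      ≤ (2 * C + 1) ^ 2 * (2 * (2 / C)) *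
        ∫ p : ℝ × ℝ, -(ε * shiftedRecip A B C ε p.2) * mixedPartial ψ 0 0 p.1 p.2
          * (mixedPartial ψ 1 2 p.1 p.2 + mixedPartial ψ 3 0 p.1 p.2) ∂stripMeasure := by
  set r := shiftedRecip A B C ε with hrdef
  set r' : ℝ → ℝ := fun y => -(6 * A * y + B) * r y ^ 2 with hr'def
  set r'' : ℝ → ℝ := fun y => -(6 * A) * r y ^ 2 + 2 * (6 * A * y + B) ^ 2 * r y ^ 3 with hr''def
  have cr : Continuous r := continuous_shiftedRecip hε
  have cr' : Continuous r' := by fun_prop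
  have cr'' : Continuous r'' := by fun_prop
  have hΦpos : ∀ y ∈ Icc (-1 : ℝ) 1, 0 < 3 * A * y ^ 2 + B * y + (C + ε) := fun y hy =>
    hε.trans_le (le_shifted_profile hC hA hB hy)
  have hrΦ : ∀ y ∈ Icc (-1 : ℝ) 1, r y * (3 * A * y ^ 2 + B * y + (C + ε)) = 1 := fun y hy => by
    rw [hrdef, shiftedRecip_eq hε hC hA hB hy, inv_mul_cancel₀ (hΦpos y hy).ne']
  have dr : ∀ y ∈ Icc (-1 : ℝ) 1, HasDerivAt r (r' y) y := fun y hy =>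
    hasDerivAt_shiftedRecip hε hC hA hB hy
  have dr' : ∀ y ∈ Icc (-1 : ℝ) 1, HasDerivAt r' (r'' y) y := fun y hy => by
    have hlin : HasDerivAt (fun t : ℝ => -(6 * A * t + B)) (-(6 * A)) y :=
      (((hasDerivAt_id y).const_mul (6 * A)).add_const B).neg.congr_deriv (by ring)
    refine (hlin.mul ((dr y hy).pow 2)).congr_deriv ?_
    simp only [hr'def, hr''def, Pi.pow_apply, Nat.cast_ofNat]
    ring
  have m00 := hm 0 0 (by norm_num)
  have m10 := hm 1 0 (by norm_num)
  have m01 := hm 0 1 (by norm_num)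
  have m02 := hm 0 2 (by norm_num)
  have m20 := hm 2 0 (by norm_num)
  have mw := memLp_weighted cr m00
  have mwy := memLp_weightedDy cr cr' m00 m01
  have cwy := continuous_weightedDy hψ cr cr' 0
  have w1 : ∀ x, weighted r ψ 0 x (-1) = 0 := fun x => by
    simp [weighted, (hbc x (-1) (Or.inl rfl)).1]
  have w2 : ∀ x, weighted r ψ 0 x 1 = 0 := fun x => by
    simp [weighted, (hbc x 1 (Or.inr rfl)).1]
  have dwy : ∀ x, ∀ y ∈ Icc (-1 : ℝ) 1,
      HasDerivAt (fun t => weighted r ψ 0 x t) (weightedDy r r' ψ 0 x y) y :=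
    fun x y hy => hasDerivAt_weighted_snd hψ 0 x (dr y hy)
  have henergy := energy_identity (D := C + ε) (ε := ε) hψ hm
    (fun x y hy => by rw [heq x y hy]; ring) hbc cr cr' cr'' dr dr' hrΦ
    (fun _ _ => rfl) (fun _ _ => rfl)
  have hhardy := integral_deriv_sq_le_of_weight (Φ := fun y => 3 * A * y ^ 2 + B * y + (C + ε)) hC
    (by fun_prop) hΦpos (fun y hy => by linarith [profile_lower_bound hA hB hy])
    (fun x y _ => hasDerivAt_weighted_fst (r := r) hψ 0 x y)
    (fun x y _ => hasDerivAt_weighted_fst (r := r) hψ 1 x y)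
    dwy (fun x y hy => hasDerivAt_weightedDy_snd hψ 0 x (dr y hy) (dr' y hy))
    (continuous_weighted hψ cr 0) (continuous_weighted hψ cr 1) cwy
    (continuous_weighted hψ cr 2) (continuous_weightedDyy hψ cr cr' cr'' 0)
    mw (memLp_weighted cr m10) mwy (memLp_weighted cr m20)
    (memLp_weightedDyy cr cr' cr'' m00 m01 m02) w1 w2
  have hpoincare : ∫ p : ℝ × ℝ, mixedPartial ψ 0 0 p.1 p.2 ^ 2 ∂stripMeasure
      ≤ ∫ p : ℝ × ℝ, (2 * C + 1) ^ 2 * (∫ t in Ioo (-1 : ℝ) 1, weightedDy r r' ψ 0 p.1 t ^ 2)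
        ∂stripMeasure := by
    refine integral_mono_ae m00.integrable_sq
      ((integrable_sq_integral_slice mwy).const_mul _) (ae_stripMeasure fun x y hy => ?_)
    have hy' := Ioo_subset_Icc_self hy
    have hb := sq_le_dist_mul_integral_deriv_sq (dwy x) (cwy.comp (Continuous.prodMk_right x))
      (w1 x) (w2 x) hy'
    simp only at hb ⊢
    set H := ∫ t in Ioo (-1 : ℝ) 1, weightedDy r r' ψ 0 x t ^ 2
    have hH : 0 ≤ H := integral_nonneg fun t => sq_nonneg _
    have hbH : weighted r ψ 0 x y ^ 2 ≤ H := by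
      have := mul_nonneg (abs_nonneg y) hH
      linarith
    have hψw : mixedPartial ψ 0 0 x y
        = (3 * A * y ^ 2 + B * y + (C + ε)) * weighted r ψ 0 x y := by
      simp only [weighted]
      linear_combination -mixedPartial ψ 0 0 x y * hrΦ y hy'
    rw [hψw, mul_pow]
    have hΦ0 := (hΦpos y hy').le
    have hΦ1 : 3 * A * y ^ 2 + B * y + (C + ε) ≤ 2 * C + 1 := by
      linarith [profile_upper_bound hA hB hy']
    gcongr
  rw [integral_const_mul, integral_sq_integral_slice mwy] at hpoincare
  have hdy : 0 ≤ ∫ p : ℝ × ℝ, weightedDy r r' ψ 0 p.1 p.2 ^ 2 ∂stripMeasure :=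
    integral_nonneg fun p => sq_nonneg _
  have hAdy := mul_nonneg (neg_nonneg.2 hA) hdy
  rw [← henergy]
  refine hpoincare.trans ?_
  rw [mul_assoc, mul_assoc]
  refine mul_le_mul_of_nonneg_left (mul_le_mul_of_nonneg_left (hhardy.trans ?_) (by norm_num))
    (by positivity)
  refine mul_le_mul_of_nonneg_left ?_ (by positivity)
  linarith

lemma tendsto_shift_error (hC : 0 < C) (hA : A ≤ 0) (hB : |B| ≤ 3 * A + C)
    {f g : ℝ × ℝ → ℝ} (hf : MemLp f 2 stripMeasure) (hg : MemLp g 2 stripMeasure) :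
    Tendsto (fun ε : ℝ => ∫ p : ℝ × ℝ, -(ε * shiftedRecip A B C ε p.2) * f p * g p ∂stripMeasure)
      (𝓝[>] 0) (𝓝 0) := by
  have hbound : ∀ ε : ℝ, 0 < ε → ∀ y ∈ Icc (-1 : ℝ) 1, 0 ≤ ε * shiftedRecip A B C ε y ∧
      ε * shiftedRecip A B C ε y ≤ 1 := fun ε hε y hy => by
    have h := le_shifted_profile (ε := ε) hC hA hB hy
    rw [shiftedRecip_eq hε hC hA hB hy, ← div_eq_mul_inv]
    exact ⟨div_nonneg hε.le (hε.le.trans h), div_le_one_of_le₀ h (hε.le.trans h)⟩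
  have hlim : Tendsto (fun ε : ℝ => ∫ p : ℝ × ℝ,
      -(ε * shiftedRecip A B C ε p.2) * f p * g p ∂stripMeasure)
      (𝓝[>] 0) (𝓝 (∫ _ : ℝ × ℝ, (0 : ℝ) ∂stripMeasure)) := by
    refine tendsto_integral_filter_of_dominated_convergence (fun p => ‖f p * g p‖) ?_ ?_
      (hf.integrable_mul hg).norm ?_
    · filter_upwards [self_mem_nhdsWithin] with ε hε
      have hc : Continuous fun y => -(ε * shiftedRecip A B C ε y) :=
        (continuous_const.mul (continuous_shiftedRecip hε)).neg
      exact (integrable_coeff_mul_mul hc hf hg).aestronglyMeasurable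
    · filter_upwards [self_mem_nhdsWithin] with ε hε
      refine ae_stripMeasure fun x y hy => ?_
      obtain ⟨h0, h1⟩ := hbound ε hε y (Ioo_subset_Icc_self hy)
      rw [mul_assoc, norm_mul, norm_neg, Real.norm_of_nonneg h0]
      exact mul_le_of_le_one_left (norm_nonneg _) h1
    · refine ae_stripMeasure fun x y hy => ?_
      have hy' := Ioo_subset_Icc_self hy
      have hF : 0 < 3 * A * y ^ 2 + B * y + C :=
        (mul_pos hC (sub_pos.2 (abs_lt.2 hy))).trans_le (profile_lower_bound hA hB hy')
      have hcoef : Tendsto (fun ε : ℝ => ε * (3 * A * y ^ 2 + B * y + (C + ε))⁻¹) (𝓝[>] 0)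
          (𝓝 0) := by
        have hcont : ContinuousAt (fun ε : ℝ => ε * (3 * A * y ^ 2 + B * y + (C + ε))⁻¹) 0 := by
          refine continuousAt_id.mul (ContinuousAt.inv₀ (by fun_prop) ?_)
          simpa using hF.ne'
        have := hcont.tendsto
        simp only [zero_mul] at this
        exact this.mono_left nhdsWithin_le_nhds
      have hcoef' : Tendsto (fun ε : ℝ => ε * shiftedRecip A B C ε y) (𝓝[>] 0) (𝓝 0) := by
        refine hcoef.congr' ?_
        filter_upwards [self_mem_nhdsWithin] with ε hε
        rw [shiftedRecip_eq hε hC hA hB hy']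
      simpa using (hcoef'.neg.mul_const (f (x, y))).mul_const (g (x, y))
  simpa using hlim

end Main

/-- Injectivity of the Couette–Poiseuille linearization in the globally finite Dirichlet
integral setting (Theorem 4.1 of the paper, stream-function form): under condition (ABC),
if `ψ` is smooth, all its partial derivatives of order between 1 and 3 are square-integrable
over the strip `S = ℝ × (-1,1)`, `ψ` solves the linearized stream-function equation
`Δ²ψ − [F(y)(ψ_xyy + ψ_xxx) − 6Aψ_x] = 0` in `S`, and `ψ = ψ_x = ψ_y = 0` on `y = ±1`,
then `ψ ≡ 0`. -/
theorem stmt_12 (A B C : ℝ) (hABC : (A, B, C) ≠ (0, 0, 0)) (hA : A ≤ 0)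
    (hB : |B| ≤ 3 * A + C) (ψ : ℝ → ℝ → ℝ)
    (hsmooth : ContDiff ℝ (⊤ : ℕ∞) (Function.uncurry ψ))
    (hL2 : ∀ i j : ℕ, 1 ≤ i + j → i + j ≤ 3 →
      IntegrableOn (fun p : ℝ × ℝ => ((pdx^[i]) ((pdy^[j]) ψ) p.1 p.2) ^ 2)
        (Set.univ ×ˢ Set.Ioo (-1 : ℝ) 1))
    (heq : ∀ x : ℝ, ∀ y ∈ Set.Ioo (-1 : ℝ) 1,
      pdx (pdx (pdx (pdx ψ))) x y + 2 * pdy (pdy (pdx (pdx ψ))) x y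
          + pdy (pdy (pdy (pdy ψ))) x y
        - ((3 * A * y ^ 2 + B * y + C) * (pdy (pdy (pdx ψ)) x y + pdx (pdx (pdx ψ)) x y)
            - 6 * A * pdx ψ x y) = 0)
    (hbc : ∀ x : ℝ, ψ x (-1) = 0 ∧ ψ x 1 = 0 ∧ pdx ψ x (-1) = 0 ∧ pdx ψ x 1 = 0 ∧
      pdy ψ x (-1) = 0 ∧ pdy ψ x 1 = 0) :
    ∀ x : ℝ, ∀ y ∈ Set.Icc (-1 : ℝ) 1, ψ x y = 0 := by
  have hC := profile_const_pos hABC hA hB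
  have hbc' : ∀ x : ℝ, ∀ y : ℝ, y = -1 ∨ y = 1 → mixedPartial ψ 0 0 x y = 0 ∧
      mixedPartial ψ 1 0 x y = 0 ∧ mixedPartial ψ 0 1 x y = 0 := by
    rintro x y (rfl | rfl)
    · exact ⟨(hbc x).1, (hbc x).2.2.1, (hbc x).2.2.2.2.1⟩
    · exact ⟨(hbc x).2.1, (hbc x).2.2.2.1, (hbc x).2.2.2.2.2⟩
  have hmpos : ∀ i j : ℕ, 1 ≤ i + j → i + j ≤ 3 →
      MemLp (fun p : ℝ × ℝ => mixedPartial ψ i j p.1 p.2) 2 stripMeasure := fun i j h1 h3 => by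
    rw [memLp_two_iff_integrable_sq (continuous_mixedPartial hsmooth i j).aestronglyMeasurable,
      stripMeasure_eq]
    exact hL2 i j h1 h3
  have hm : ∀ i j : ℕ, i + j ≤ 3 →
      MemLp (fun p : ℝ × ℝ => mixedPartial ψ i j p.1 p.2) 2 stripMeasure := fun i j h3 => by
    rcases Nat.eq_zero_or_pos (i + j) with h0 | h1
    · obtain ⟨rfl, rfl⟩ : i = 0 ∧ j = 0 := by omega
      exact memLp_of_memLp_deriv_snd (continuous_mixedPartial hsmooth 0 0)
        (fun x y _ => hasDerivAt_mixedPartial_snd hsmooth 0 0 x y)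
        (continuous_mixedPartial hsmooth 0 1) (fun x => (hbc' x (-1) (Or.inl rfl)).1)
        (fun x => (hbc' x 1 (Or.inr rfl)).1) (hmpos 0 1 (by norm_num) (by norm_num))
    · exact hmpos i j h1 h3
  have heq' : ∀ x : ℝ, ∀ y ∈ Ioo (-1 : ℝ) 1,
      mixedPartial ψ 4 0 x y + 2 * mixedPartial ψ 2 2 x y + mixedPartial ψ 0 4 x y
        = (3 * A * y ^ 2 + B * y + C) * (mixedPartial ψ 1 2 x y + mixedPartial ψ 3 0 x y)
            - 6 * A * mixedPartial ψ 1 0 x y := fun x y hy => by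
    have h := heq x y hy
    have hyy : ∀ i, pdy (pdy (mixedPartial ψ i 0)) = mixedPartial ψ i 2 := fun i => by
      rw [pdy_mixedPartial hsmooth, pdy_mixedPartial hsmooth]
    rw [show pdy (pdy (pdx (pdx ψ))) = mixedPartial ψ 2 2 from hyy 2,
      show pdy (pdy (pdx ψ)) = mixedPartial ψ 1 2 from hyy 1] at h
    exact sub_eq_zero.1 h
  have hlim := (tendsto_shift_error hC hA hB (hm 0 0 (by norm_num))
    ((hm 1 2 (by norm_num)).add (hm 3 0 (by norm_num)))).const_mul
      ((2 * C + 1) ^ 2 * (2 * (2 / C)))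
  rw [mul_zero] at hlim
  have hle : ∫ p : ℝ × ℝ, mixedPartial ψ 0 0 p.1 p.2 ^ 2 ∂stripMeasure ≤ 0 := by
    refine ge_of_tendsto hlim ?_
    filter_upwards [Ioc_mem_nhdsGT (show (0 : ℝ) < 1 by norm_num)] with ε hε
    exact integral_sq_le_shift_error hC hA hB hsmooth hm heq' hbc' hε.1 hε.2
  have hae := (integral_eq_zero_iff_of_nonneg (fun p => sq_nonneg _)
    (hm 0 0 (by norm_num)).integrable_sq).1 (le_antisymm hle (integral_nonneg fun p => sq_nonneg _))
  have hc0 : Continuous (fun p : ℝ × ℝ => mixedPartial ψ 0 0 p.1 p.2 ^ 2) :=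
    (continuous_mixedPartial hsmooth 0 0).pow 2
  rw [stripMeasure_eq] at hae
  have hzero := Measure.eqOn_open_of_ae_eq hae (isOpen_univ.prod isOpen_Ioo) hc0.continuousOn
    continuousOn_const
  intro x y hy
  rcases eq_endpoints_or_mem_Ioo_of_mem_Icc hy with rfl | rfl | hy
  · exact (hbc x).1
  · exact (hbc x).2.1
  · exact pow_eq_zero_iff two_ne_zero |>.1 (hzero (x := (x, y)) ⟨mem_univ _, hy⟩)
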